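/- Let (θ, k) be a finite arc coloring of the unit circle with n arcs that is proper. Then there exist m with 3 ≤ m ≤ n, a strictly monotone injection σ : Fin m → Fin n, and colors k' : Fin m → Fin 3 such that the finite arc coloring with breakpoint angles θ ∘ σ and arc colors k' is proper and cyclic. (In the paper's language: some monochromatic arcs can be recolored so that the coloring of the circle becomes cyclic while remaining proper, creating no new bichromatic points: the bichromatic points of the new coloring form a subset of the original breakpoints.) -/

import Mathlib

/-- The point of the unit circle in the Euclidean plane at angle `t`. -/
noncomputable def circlePt (t : ℝ) : EuclideanSpace ℝ (Fin 2) :=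
  (EuclideanSpace.equiv (Fin 2) ℝ).symm ![Real.cos t, Real.sin t]

/-- The right endpoint angle of the `i`-th arc of a finite arc coloring (cyclically, with
`θ n` meaning `θ 0 + 2π`). -/
noncomputable def arcEnd (n : ℕ) (hn : n ≠ 0) (θ : Fin n → ℝ) (i : Fin n) : ℝ :=
  haveI : NeZero n := ⟨hn⟩
  if (i : ℕ) + 1 = n then θ 0 + 2 * Real.pi else θ (i + 1)

/-- A finite arc coloring of the unit circle, given by strictly increasing breakpoint angles
`θ` with `θ (n-1) < θ 0 + 2π` and arc colors `k`, is proper if cyclically adjacent arcs have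
different colors, monochromatic points at distance 1 have different colors, and bichromatic
points at distance 1 have different multicolors. -/
def IsProperArcColoring (n : ℕ) (hn : n ≠ 0) (θ : Fin n → ℝ) (k : Fin n → Fin 3) : Prop :=
  haveI : NeZero n := ⟨hn⟩
  StrictMono θ ∧
  θ ⟨n - 1, Nat.sub_lt (Nat.pos_of_ne_zero hn) one_pos⟩ < θ 0 + 2 * Real.pi ∧
  (∀ i : Fin n, k (i + 1) ≠ k i) ∧
  (∀ i j : Fin n, ∀ s t : ℝ, s ∈ Set.Ioo (θ i) (arcEnd n hn θ i) →
    t ∈ Set.Ioo (θ j) (arcEnd n hn θ j) →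
    dist (circlePt s) (circlePt t) = 1 → k i ≠ k j) ∧
  (∀ i j : Fin n, i ≠ j → dist (circlePt (θ i)) (circlePt (θ j)) = 1 →
    ({k (i - 1), k i} : Set (Fin 3)) ≠ {k (j - 1), k j})

/-- A finite arc coloring is cyclic if no arc is bordered on both sides by arcs of the same
color. -/
def IsCyclicArcColoring (n : ℕ) (hn : n ≠ 0) (k : Fin n → Fin 3) : Prop :=
  haveI : NeZero n := ⟨hn⟩
  ∀ i : Fin n, k (i + 1) ≠ k (i - 1)

def WP (c : ℤ → Fin 3) (d : ℤ) : Prop :=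
  (∀ i, c i ≠ c (i + d)) ∧ ∀ i, ¬ (c i = c (i + d - 1) ∧ c (i - 1) = c (i + d))

def Rfx (c : ℤ → Fin 3) (p q : ℤ) : Prop :=
  p < q ∧ c (p - 1) ≠ c p ∧ (∀ w, p ≤ w → w < q → c w = c p) ∧ c q = c (p - 1)

lemma WP.neg {c : ℤ → Fin 3} {d : ℤ} (h : WP c d) : WP c (-d) := by
  refine ⟨fun i hi => h.1 (i + -d) ?_, fun i hi => h.2 (i + -d) ⟨?_, ?_⟩⟩
  · rw [← hi]; congr 1; ring
  · rw [← hi.2]; congr 1; ring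
  · rw [← hi.1]; congr 1; ring

lemma run_down (c : ℤ → Fin 3) (b : Fin 3) (x : ℤ) (hx : c x ≠ b) (m : ℕ) :
    ∀ y, y = x + m → c y = b → ∃ u, x < u ∧ u ≤ y ∧ c (u - 1) ≠ b ∧
      ∀ w, u ≤ w → w ≤ y → c w = b := by
  induction m with
  | zero => intro y hy hb; simp at hy; subst hy; exact absurd hb hx
  | succ m ih =>
    intro y hy hb
    push_cast at hy
    by_cases h : c (y - 1) = b
    · obtain ⟨u, h1, h2, h3, h4⟩ := ih (y - 1) (by omega) h
      refine ⟨u, h1, by omega, h3, fun w hw hw' => ?_⟩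
      rcases eq_or_lt_of_le hw' with e | e
      · rw [e]; exact hb
      · exact h4 w hw (by omega)
    · refine ⟨y, by omega, le_rfl, h, fun w hw hw' => ?_⟩
      have : w = y := by omega
      rw [this]; exact hb

lemma run_up (c : ℤ → Fin 3) (b : Fin 3) (x : ℤ) (hx : c x ≠ b) (y : ℤ) (hxy : y < x)
    (hb : c y = b) : ∃ v, y < v ∧ v ≤ x ∧ c v ≠ b ∧ ∀ w, y ≤ w → w < v → c w = b := by
  obtain ⟨u, h1, h2, h3, h4⟩ := run_down (fun i => c (-i)) b (-x) (by simpa using hx)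
    (x - y).toNat (-y) (by omega) (by simpa using hb)
  refine ⟨-u + 1, by omega, by omega, ?_, fun w hw hw' => ?_⟩
  · have : -(u - 1) = -u + 1 := by ring
    simpa [this] using h3
  · simpa using h4 (-w) (by omega) (by omega)

lemma fin3_third {a b x y : Fin 3} (hab : a ≠ b) (hxa : x ≠ a) (hxb : x ≠ b)
    (hya : y ≠ a) (hyb : y ≠ b) : x = y := by
  revert a b x y; decide

lemma shift_rfx {c : ℤ → Fin 3} {d p q : ℤ} (hW : WP c d) (hR : Rfx c p q)
    (hmin : ∀ u v, Rfx c u v → q - p ≤ v - u) (i : ℤ) (hi : p ≤ i) (hi' : i < q)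
    (hc : c (i + d) = c (p - 1)) : Rfx c (p + d) (q + d) := by
  obtain ⟨hpq, hne, hrun, hq⟩ := hR
  have hl : c (p - 1 + d) ≠ c (p - 1) := (hW.1 (p - 1)).symm
  have hr : c (q + d) ≠ c (p - 1) := by rw [← hq]; exact (hW.1 q).symm
  obtain ⟨u, hu1, hu2, hu3, hu4⟩ := run_down c (c (p - 1)) (p - 1 + d) hl
    (i - (p - 1)).toNat (i + d) (by omega) hc
  obtain ⟨v, hv1, hv2, hv3, hv4⟩ := run_up c (c (p - 1)) (q + d) hr (i + d) (by omega) hc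
  have hall : ∀ w, u ≤ w → w < v → c w = c (p - 1) := by
    intro w h1 h2
    by_cases h : w ≤ i + d
    · exact hu4 w h1 h
    · exact hv4 w (by omega) h2
  have hua : c (u - 1) ≠ c p := by
    by_cases h : u = p + d
    · subst h
      intro h'
      exact hW.2 p ⟨h'.symm, (hall (p + d) le_rfl (by omega)).symm⟩
    · have h1 := hW.1 (u - 1 - d)
      rw [hrun (u - 1 - d) (by omega) (by omega), sub_add_cancel] at h1
      exact h1.symm
  have hva : c v ≠ c p := by
    by_cases h : v = q + d
    · subst h
      intro h'
      refine hW.2 q ⟨?_, ?_⟩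
      · rw [hq, hall (q + d - 1) (by omega) (by omega)]
      · rw [h', hrun (q - 1) (by omega) (by omega)]
    · have h1 := hW.1 (v - d)
      rw [hrun (v - d) (by omega) (by omega), sub_add_cancel] at h1
      exact h1.symm
  have hR' : Rfx c u v := by
    have hcu := hall u le_rfl (by omega)
    refine ⟨by omega, by rw [hcu]; exact hu3, fun w h1 h2 => by rw [hcu, hall w h1 h2], ?_⟩
    exact fin3_third hne.symm hva hv3 hua hu3
  have := hmin u v hR'
  have e1 : u = p + d := by omega
  have e2 : v = q + d := by omega
  rw [← e1, ← e2]; exact hR'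

lemma exists_min_rfx {c : ℤ → Fin 3} (h : ∃ p q, Rfx c p q) :
    ∃ p q, Rfx c p q ∧ ∀ u v, Rfx c u v → q - p ≤ v - u := by
  classical
  have h' : ∃ L : ℕ, ∃ p q, Rfx c p q ∧ q - p = L := by
    obtain ⟨p, q, hR⟩ := h
    exact ⟨(q - p).toNat, p, q, hR, by have := hR.1; omega⟩
  obtain ⟨p, q, hR, hL⟩ := Nat.find_spec h'
  refine ⟨p, q, hR, fun u v huv => ?_⟩
  have := Nat.find_min' h' ⟨u, v, huv, (by have := huv.1; omega : v - u = ((v - u).toNat : ℤ))⟩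
  have := huv.1
  omega

lemma comb_step {c : ℤ → Fin 3} {M : ℤ} (hM : 0 < M) (hW : WP c M)
    (hper : ∀ i, c (i + 6 * M) = c i) (hex : ∃ p q, Rfx c p q) :
    ∃ c' : ℤ → Fin 3, WP c' M ∧ (∀ i, c' (i + 6 * M) = c' i) ∧
      (∀ i, c' (i - 1) ≠ c' i → c (i - 1) ≠ c i) ∧ ∃ p, c (p - 1) ≠ c p ∧ c' (p - 1) = c' p := by
  classical
  obtain ⟨p, q, hR, hmin⟩ := exists_min_rfx hex
  have hL : q - p < M := by
    obtain ⟨hpq, hne, hrun, hq⟩ := hR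
    by_contra hcon
    rcases eq_or_lt_of_le (not_lt.mp hcon) with e | e
    · have e' : q = p + M := by omega
      refine hW.2 p ⟨(hrun _ (by omega) (by omega)).symm, ?_⟩
      rw [← e', hq]
    · exact hW.1 p (hrun _ (by omega) (by omega)).symm
  have huniq : ∀ z z' i : ℤ, p + z * M - 1 ≤ i → i < q + z * M → p + z' * M - 1 ≤ i →
      i < q + z' * M → z = z' := by
    intro z z' i h1 h2 h3 h4
    rcases lt_trichotomy z z' with h | h | h
    · nlinarith
    · exact h
    · nlinarith
  obtain ⟨c', hA, hB⟩ : ∃ c' : ℤ → Fin 3,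
      (∀ z i, Rfx c (p + z * M) (q + z * M) → p + z * M ≤ i → i < q + z * M →
        c' i = c (p + z * M - 1)) ∧
      (∀ i, (∀ z, Rfx c (p + z * M) (q + z * M) → p + z * M ≤ i → i < q + z * M → False) →
        c' i = c i) := by
    refine ⟨fun i => if h : ∃ z, Rfx c (p + z * M) (q + z * M) ∧ p + z * M ≤ i ∧ i < q + z * M
      then c (p + h.choose * M - 1) else c i, ?_, ?_⟩
    · intro z i h1 h2 h3
      have h : ∃ z, Rfx c (p + z * M) (q + z * M) ∧ p + z * M ≤ i ∧ i < q + z * M :=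
        ⟨z, h1, h2, h3⟩
      have hs := h.choose_spec
      have : h.choose = z := huniq _ _ i (by omega) hs.2.2 (by omega) h3
      simp only [dif_pos h, this]
    · intro i hi
      have h : ¬ ∃ z, Rfx c (p + z * M) (q + z * M) ∧ p + z * M ≤ i ∧ i < q + z * M := by
        rintro ⟨z, h1, h2, h3⟩; exact hi z h1 h2 h3
      simp only [dif_neg h]
  -- behaviour of a block index
  have hA0 : ∀ z, Rfx c (p + z * M) (q + z * M) → c' (p + z * M - 1) = c (p + z * M - 1) := by
    intro z hz
    refine hB _ fun z' hz' h1 h2 => ?_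
    have := huniq z z' (p + z * M - 1) (by omega) (by have := hz.1; omega) (by omega) h2
    subst this; omega
  have hA1 : ∀ z, Rfx c (p + z * M) (q + z * M) → c' (q + z * M) = c (q + z * M) := by
    intro z hz
    refine hB _ fun z' hz' h1 h2 => ?_
    have := huniq z z' (q + z * M - 1) (by have := hz.1; omega) (by omega) (by omega) (by omega)
    subst this; omega
  have hD : ∀ i, c' (i - 1) ≠ c' i → c' i = c i ∧ c' (i - 1) = c (i - 1) := by
    intro i hi
    constructor
    · refine hB _ fun z hz h1 h2 => hi ?_
      rw [hA z i hz h1 h2]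
      by_cases h : i = p + z * M
      · rw [h]; exact hA0 z hz
      · exact hA z _ hz (by omega) (by omega)
    · refine hB _ fun z hz h1 h2 => hi ?_
      rw [hA z (i - 1) hz h1 h2]
      by_cases h : i = q + z * M
      · rw [h, hA1 z hz, hz.2.2.2]
      · exact (hA z _ hz (by omega) (by omega)).symm
  have hminz : ∀ z : ℤ, ∀ u v, Rfx c u v → (q + z * M) - (p + z * M) ≤ v - u := by
    intro z u v h; have := hmin u v h; omega
  have hW1 : ∀ i, c' i ≠ c' (i + M) := by
    intro i
    by_cases hi : ∃ z, Rfx c (p + z * M) (q + z * M) ∧ p + z * M ≤ i ∧ i < q + z * M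
    · obtain ⟨z, hz, h1, h2⟩ := hi
      rw [hA z i hz h1 h2]
      have ep : p + (z + 1) * M = p + z * M + M := by ring
      have eq : q + (z + 1) * M = q + z * M + M := by ring
      by_cases hz' : Rfx c (p + (z + 1) * M) (q + (z + 1) * M)
      · rw [hA (z + 1) (i + M) hz' (by omega) (by omega), ep]
        have := hW.1 (p + z * M - 1)
        rwa [show p + z * M - 1 + M = p + z * M + M - 1 by ring] at this
      · rw [hB (i + M) ?_]
        · intro hcc
          apply hz'
          rw [ep, eq]
          exact shift_rfx hW hz (hminz z) i h1 h2 hcc.symm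
        · intro z' hz'' h3 h4
          have := huniq (z + 1) z' (i + M) (by omega) (by omega) (by omega) h4
          subst this; exact hz' hz''
    · have hi' : c' i = c i := hB i fun z h1 h2 h3 => hi ⟨z, h1, h2, h3⟩
      rw [hi']
      by_cases hj : ∃ z, Rfx c (p + z * M) (q + z * M) ∧ p + z * M ≤ i + M ∧ i + M < q + z * M
      · obtain ⟨z, hz, h1, h2⟩ := hj
        rw [hA z _ hz h1 h2]
        intro hcc
        have := shift_rfx hW.neg hz (hminz z) (i + M) h1 h2 (by rw [← hcc]; congr 1; ring)
        have ep : p + (z - 1) * M = p + z * M + -M := by ring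
        have eq : q + (z - 1) * M = q + z * M + -M := by ring
        rw [← ep, ← eq] at this
        exact hi ⟨z - 1, this, by omega, by omega⟩
      · rw [hB (i + M) fun z h1 h2 h3 => hj ⟨z, h1, h2, h3⟩]
        exact hW.1 i
  have hrper : ∀ u v, Rfx c u v ↔ Rfx c (u + 6 * M) (v + 6 * M) := by
    intro u v
    have e : u + 6 * M - 1 = u - 1 + 6 * M := by ring
    unfold Rfx
    rw [e, hper, hper, hper]
    refine and_congr (by omega) (and_congr Iff.rfl (and_congr ⟨fun h w h1 h2 => ?_,
      fun h w h1 h2 => ?_⟩ Iff.rfl))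
    · rw [← h (w - 6 * M) (by omega) (by omega), ← hper (w - 6 * M), sub_add_cancel]
    · rw [← h (w + 6 * M) (by omega) (by omega), hper]
  refine ⟨c', ⟨hW1, ?_⟩, ?_, ?_, ?_⟩
  · rintro i ⟨h1, h2⟩
    have hne : c' (i - 1) ≠ c' i := by
      rw [h2]; exact (hW1 i).symm
    have hne' : c' (i + M - 1) ≠ c' (i + M) := by
      rw [← h1]; exact hW1 i
    obtain ⟨a1, a2⟩ := hD _ hne
    obtain ⟨b1, b2⟩ := hD _ hne'
    exact hW.2 i ⟨by rw [← a1, ← b2, h1], by rw [← a2, ← b1, h2]⟩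
  · intro i
    have ep : ∀ z, p + (z + 6) * M = p + z * M + 6 * M := fun z => by ring
    have eq : ∀ z, q + (z + 6) * M = q + z * M + 6 * M := fun z => by ring
    by_cases hi : ∃ z, Rfx c (p + z * M) (q + z * M) ∧ p + z * M ≤ i ∧ i < q + z * M
    · obtain ⟨z, hz, h1, h2⟩ := hi
      rw [hA z i hz h1 h2, hA (z + 6) (i + 6 * M) (by rw [ep, eq]; exact (hrper _ _).1 hz)
        (by rw [ep]; omega) (by rw [eq]; omega), ep, ← hper (p + z * M - 1)]
      congr 1; ring
    · rw [hB i fun z h1 h2 h3 => hi ⟨z, h1, h2, h3⟩, hB, hper]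
      intro z h1 h2 h3
      have ep := ep (z - 6)
      have eq := eq (z - 6)
      rw [sub_add_cancel] at ep eq
      rw [ep, eq] at h1
      exact hi ⟨z - 6, (hrper _ _).2 h1, by omega, by omega⟩
  · intro i hi
    obtain ⟨a1, a2⟩ := hD _ hi
    rw [← a1, ← a2]; exact hi
  · have hz : Rfx c (p + 0 * M) (q + 0 * M) := by simpa using hR
    have h0 := hA0 0 hz
    have h1 := hA 0 p hz (by omega) (by have := hR.1; omega)
    simp only [zero_mul, add_zero] at h0 h1
    exact ⟨p, hR.2.1, by rw [h0, h1]⟩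

lemma comb_main {M : ℤ} (hM : 0 < M) (N : ℕ) : ∀ (c : ℤ → Fin 3), WP c M →
    (∀ i, c (i + 6 * M) = c i) →
    ((Finset.Ico 0 (6 * M)).filter (fun i => c (i - 1) ≠ c i)).card = N →
    ∃ c' : ℤ → Fin 3, WP c' M ∧ (∀ i, c' (i + 6 * M) = c' i) ∧
      (∀ i, c' (i - 1) ≠ c' i → c (i - 1) ≠ c i) ∧ ∀ p q, ¬ Rfx c' p q := by
  induction N using Nat.strong_induction_on with
  | _ N ih =>
    intro c hW hper hN
    by_cases hex : ∃ p q, Rfx c p q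
    · obtain ⟨c', hW', hper', hD, p, hp1, hp2⟩ := comb_step hM hW hper hex
      have hmod : ∀ (f : ℤ → Fin 3), (∀ i, f (i + 6 * M) = f i) → ∀ i, f (i % (6 * M)) = f i := by
        intro f hf i
        have hf' : Function.Periodic f (6 * M) := hf
        have := hf'.int_mul (i / (6 * M)) (i % (6 * M))
        rw [← this]
        congr 1
        have := Int.emod_add_mul_ediv i (6 * M)
        simp only [Int.cast_id]
        linarith
      have hlt : ((Finset.Ico 0 (6 * M)).filter (fun i => c' (i - 1) ≠ c' i)).card < N := by
        rw [← hN]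
        apply Finset.card_lt_card
        rw [Finset.ssubset_iff_of_subset]
        · refine ⟨p % (6 * M), ?_, ?_⟩
          · simp only [Finset.mem_filter, Finset.mem_Ico]
            refine ⟨⟨Int.emod_nonneg _ (by omega), Int.emod_lt_of_pos _ (by omega)⟩, ?_⟩
            rw [hmod c hper]
            have := hmod (fun i => c (i - 1)) (fun i => by
              rw [← hper (i - 1)]; congr 1; ring) p
            rw [this]; exact hp1
          · simp only [Finset.mem_filter, Finset.mem_Ico, not_and, not_not]
            intro _
            rw [hmod c' hper']
            have := hmod (fun i => c' (i - 1)) (fun i => by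
              rw [← hper' (i - 1)]; congr 1; ring) p
            rw [this]; exact hp2
        · intro i
          simp only [Finset.mem_filter]
          exact fun h => ⟨h.1, hD i h.2⟩
      obtain ⟨c'', h1, h2, h3, h4⟩ := ih _ hlt c' hW' hper' rfl
      exact ⟨c'', h1, h2, fun i hi => hD i (h3 i hi), h4⟩
    · exact ⟨c, hW, hper, fun i hi => hi, fun p q h => hex ⟨p, q, h⟩⟩

lemma dist_sq_circlePt (s t : ℝ) :
    dist (circlePt s) (circlePt t) ^ 2 = 2 - 2 * Real.cos (s - t) := by
  rw [EuclideanSpace.dist_eq, Real.sq_sqrt (Finset.sum_nonneg fun _ _ => sq_nonneg _)]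
  simp only [Fin.sum_univ_two, Real.dist_eq, sq_abs]
  simp [circlePt, Real.cos_sub]
  nlinarith [Real.sin_sq_add_cos_sq s, Real.sin_sq_add_cos_sq t]

lemma dist_one_iff (s t : ℝ) : dist (circlePt s) (circlePt t) = 1 ↔ Real.cos (s - t) = 1 / 2 := by
  have h := dist_sq_circlePt s t
  have h0 : 0 ≤ dist (circlePt s) (circlePt t) := dist_nonneg
  constructor
  · intro h1; rw [h1] at h; linarith
  · intro h1; rw [h1] at h
    nlinarith

lemma dist_one_cases {s t : ℝ} (h : dist (circlePt s) (circlePt t) = 1) :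
    ∃ q : ℤ, t = s + Real.pi / 3 + 2 * Real.pi * q ∨ s = t + Real.pi / 3 + 2 * Real.pi * q := by
  rw [dist_one_iff, ← Real.cos_pi_div_three, eq_comm, Real.cos_eq_cos_iff] at h
  obtain ⟨q, h | h⟩ := h
  · exact ⟨q, Or.inr (by linarith)⟩
  · exact ⟨-q, Or.inl (by push_cast; linarith)⟩

lemma dist_one_of (s : ℝ) (q : ℤ) {t : ℝ} (ht : t = s + Real.pi / 3 + 2 * Real.pi * q) :
    dist (circlePt s) (circlePt t) = 1 := by
  rw [dist_one_iff, ← Real.cos_pi_div_three, eq_comm, Real.cos_eq_cos_iff]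
  exact ⟨-q, Or.inr (by push_cast; linarith)⟩

/-- angles in order -/
structure ArcOrd (n : ℕ) [NeZero n] (θ : Fin n → ℝ) : Prop where
  mono : StrictMono θ
  last : ∀ j, θ j < θ 0 + 2 * Real.pi

section ord
variable {n : ℕ} [NeZero n] {θ : Fin n → ℝ}

/-- end angle of an arc -/
noncomputable abbrev aE (θ : Fin n → ℝ) (i : Fin n) : ℝ := arcEnd n (NeZero.ne n) θ i

lemma aE_cases (θ : Fin n → ℝ) (i : Fin n) :
    ((i : ℕ) + 1 < n ∧ ((i + 1 : Fin n) : ℕ) = i + 1 ∧ aE θ i = θ (i + 1)) ∨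
    ((i : ℕ) + 1 = n ∧ i + 1 = 0 ∧ aE θ i = θ (i + 1) + 2 * Real.pi) := by
  have hi := i.isLt
  by_cases h : (i : ℕ) + 1 = n
  · right
    have h0 : i + 1 = 0 := by
      apply Fin.ext
      rw [Fin.val_add, Fin.val_one', Nat.add_mod_mod, h]
      simp
    refine ⟨h, h0, ?_⟩
    rw [h0]
    simp [aE, arcEnd, h]
  · left
    refine ⟨by omega, ?_, ?_⟩
    · rw [Fin.val_add, Fin.val_one', Nat.add_mod_mod, Nat.mod_eq_of_lt (by omega)]
    · simp [aE, arcEnd, h]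

lemma ArcOrd.zero_le (h : ArcOrd n θ) (j : Fin n) : θ 0 ≤ θ j := h.mono.monotone (Fin.zero_le j)

lemma ArcOrd.lt_aE (h : ArcOrd n θ) (i : Fin n) : θ i < aE θ i := by
  rcases aE_cases θ i with ⟨_, h2, h3⟩ | ⟨_, h2, h3⟩
  · rw [h3]; exact h.mono (by rw [Fin.lt_def]; omega)
  · rw [h3, h2]; exact h.last i

lemma ArcOrd.aE_le (h : ArcOrd n θ) (i : Fin n) : aE θ i ≤ θ 0 + 2 * Real.pi := by
  rcases aE_cases θ i with ⟨_, h2, h3⟩ | ⟨_, h2, h3⟩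
  · rw [h3]; exact (h.last _).le
  · rw [h3, h2]

lemma ArcOrd.aE_le_of_lt (h : ArcOrd n θ) {i j : Fin n} (hij : i < j) : aE θ i ≤ θ j := by
  have hj := j.isLt
  rw [Fin.lt_def] at hij
  rcases aE_cases θ i with ⟨_, h2, h3⟩ | ⟨h1, h2, h3⟩
  · rw [h3]; exact h.mono.monotone (by rw [Fin.le_def]; omega)
  · omega

lemma ArcOrd.no_break (h : ArcOrd n θ) (i j : Fin n) (q : ℤ)
    (h1 : θ i < θ j + 2 * Real.pi * q) (h2 : θ j + 2 * Real.pi * q < aE θ i) : False := by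
  have hpi := Real.pi_pos
  rcases lt_trichotomy q 0 with hq | hq | hq
  · have : (q : ℝ) ≤ -1 := by exact_mod_cast (by omega : q ≤ -1)
    have := h.last j
    have := h.zero_le i
    nlinarith
  · subst hq
    simp only [Int.cast_zero, mul_zero, add_zero] at h1 h2
    have := h.aE_le_of_lt (h.mono.lt_iff_lt.1 h1)
    linarith
  · have : (1 : ℝ) ≤ q := by exact_mod_cast (by omega : 1 ≤ q)
    have := h.aE_le i
    have := h.zero_le j
    nlinarith

lemma ArcOrd.uniq (h : ArcOrd n θ) (i j : Fin n) (q r : ℤ) (t : ℝ)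
    (h1 : θ i + 2 * Real.pi * q ≤ t) (h2 : t < aE θ i + 2 * Real.pi * q)
    (h3 : θ j + 2 * Real.pi * r ≤ t) (h4 : t < aE θ j + 2 * Real.pi * r) : i = j := by
  have hpi := Real.pi_pos
  rcases lt_trichotomy (θ i + 2 * Real.pi * q) (θ j + 2 * Real.pi * r) with hh | hh | hh
  · exact (h.no_break i j (r - q) (by push_cast; linarith) (by push_cast; linarith)).elim
  · have a1 := h.last i
    have a2 := h.last j
    have a3 := h.zero_le i
    have a4 := h.zero_le j
    have : q = r := by
      rcases lt_trichotomy q r with hq | hq | hq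
      · have : (q : ℝ) + 1 ≤ r := by exact_mod_cast hq
        nlinarith
      · exact hq
      · have : (r : ℝ) + 1 ≤ q := by exact_mod_cast hq
        nlinarith
    subst this
    exact h.mono.injective (by linarith)
  · exact (h.no_break j i (q - r) (by push_cast; linarith) (by push_cast; linarith)).elim

lemma ArcOrd.cover (h : ArcOrd n θ) (t : ℝ) : ∃ (j : Fin n) (q : ℤ),
    θ j + 2 * Real.pi * q ≤ t ∧ t < aE θ j + 2 * Real.pi * q := by
  obtain ⟨q, ⟨hq1, hq2⟩, -⟩ := existsUnique_add_zsmul_mem_Ico Real.two_pi_pos t (θ 0)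
  simp only [zsmul_eq_mul] at hq1 hq2
  obtain ⟨j, hj, hjmax⟩ := Finset.exists_max_image
    (Finset.univ.filter fun j => θ j ≤ t + q * (2 * Real.pi)) id ⟨0, by simpa using hq1⟩
  simp only [Finset.mem_filter, Finset.mem_univ, true_and, id] at hj hjmax
  refine ⟨j, -q, by push_cast; linarith, ?_⟩
  have : t + q * (2 * Real.pi) < aE θ j := by
    rcases aE_cases θ j with ⟨_, h2, h3⟩ | ⟨_, h2, h3⟩
    · rw [h3]
      by_contra hcon
      have := hjmax (j + 1) (not_lt.1 hcon)
      rw [Fin.le_def] at this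
      omega
    · rw [h3, h2]; exact hq2
  push_cast; linarith

end ord

/-- A grid invariant under rotation by `π/3`. -/
structure Grid (M : ℤ) (e : ℤ → ℝ) : Prop where
  pos : 0 < M
  mono : StrictMono e
  shift : ∀ i, e (i + M) = e i + Real.pi / 3

lemma Grid.shift_mul {M : ℤ} {e : ℤ → ℝ} (g : Grid M e) (z i : ℤ) :
    e (i + z * M) = e i + z * (Real.pi / 3) := by
  induction z using Int.induction_on with
  | zero => simp
  | succ z ih =>
    have := g.shift (i + z * M)
    rw [show i + ((z : ℤ) + 1) * M = i + z * M + M by ring, this, ih]; push_cast; ring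
  | pred z ih =>
    have := g.shift (i + (-(z : ℤ) - 1) * M)
    rw [show i + (-(z : ℤ) - 1) * M + M = i + -(z : ℤ) * M by ring, ih] at this
    push_cast at this ⊢; linarith

lemma Grid.shift_six {M : ℤ} {e : ℤ → ℝ} (g : Grid M e) (q i : ℤ) :
    e (i + 6 * M * q) = e i + 2 * Real.pi * q := by
  have := g.shift_mul (6 * q) i
  rw [show i + 6 * M * q = i + 6 * q * M by ring, this]; push_cast; ring

lemma Grid.floor {M : ℤ} {e : ℤ → ℝ} (g : Grid M e) (t : ℝ) : ∃ p, e p ≤ t ∧ t < e (p + 1) := by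
  have hpi := Real.pi_pos
  obtain ⟨z, hz⟩ := exists_int_gt ((t - e 0) / (Real.pi / 3))
  obtain ⟨y, hy⟩ := exists_int_lt ((t - e 0) / (Real.pi / 3))
  rw [div_lt_iff₀ (by positivity)] at hz
  rw [lt_div_iff₀ (by positivity)] at hy
  have hz' := g.shift_mul z 0
  have hy' := g.shift_mul y 0
  obtain ⟨p, hp, hmax⟩ := Int.exists_greatest_of_bdd (P := fun p => e p ≤ t)
    ⟨0 + z * M, fun p hp => by
      refine (g.mono.lt_iff_lt.1 (?_ : e p < e (0 + z * M))).le
      rw [hz']; linarith⟩ ⟨0 + y * M, by rw [hy']; linarith⟩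
  refine ⟨p, hp, ?_⟩
  by_contra hcon
  have := hmax (p + 1) (not_lt.1 hcon)
  omega

lemma exists_grid {n : ℕ} [NeZero n] (θ : Fin n → ℝ) :
    ∃ (M : ℤ) (e : ℤ → ℝ), Grid M e ∧ ∀ j, ∃ i, e i = θ j := by
  classical
  have hα : (0 : ℝ) < Real.pi / 3 := by have := Real.pi_pos; positivity
  set E : Finset ℝ := Finset.univ.image (fun j => toIcoMod hα 0 (θ j)) with hE
  have hEne : E.Nonempty := ⟨_, Finset.mem_image_of_mem _ (Finset.mem_univ 0)⟩
  have hEmem : ∀ x ∈ E, 0 ≤ x ∧ x < Real.pi / 3 := by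
    intro x hx
    rw [hE, Finset.mem_image] at hx
    obtain ⟨j, -, rfl⟩ := hx
    have := toIcoMod_mem_Ico hα 0 (θ j)
    simpa using this
  obtain ⟨m, hm⟩ : ∃ m, E.card = m := ⟨_, rfl⟩
  have hmpos : 0 < m := by rw [← hm]; exact hEne.card_pos
  set f := E.orderEmbOfFin hm with hf
  have hfm : ∀ x, 0 ≤ f x ∧ f x < Real.pi / 3 := fun x => hEmem _ (Finset.orderEmbOfFin_mem E hm x)
  have hmod : ∀ i : ℤ, (i % m).toNat < m := by
    intro i
    have := Int.emod_nonneg i (by omega : (m : ℤ) ≠ 0)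
    have := Int.emod_lt_of_pos i (by omega : 0 < (m : ℤ))
    omega
  have hkey : ∀ (r : ℕ) (hr : r < m) (q : ℤ), ((r : ℤ) + m * q) / m = q ∧
      (⟨_, hmod ((r : ℤ) + m * q)⟩ : Fin m) = ⟨r, hr⟩ := by
    intro r hr q
    have h1 : ((r : ℤ) + m * q) % m = r := by
      rw [Int.add_mul_emod_self_left, Int.emod_eq_of_lt (by omega) (by omega)]
    refine ⟨?_, ?_⟩
    · rw [Int.add_mul_ediv_left _ _ (by omega), Int.ediv_eq_zero_of_lt (by omega) (by omega)]; ring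
    · apply Fin.ext; simp only [h1]; omega
  obtain ⟨e, he⟩ : ∃ e : ℤ → ℝ, ∀ (r : ℕ) (hr : r < m) (q : ℤ),
      e ((r : ℤ) + m * q) = f ⟨r, hr⟩ + q * (Real.pi / 3) := by
    refine ⟨fun i => f ⟨_, hmod i⟩ + (i / m : ℤ) * (Real.pi / 3), fun r hr q => ?_⟩
    obtain ⟨h1, h2⟩ := hkey r hr q
    simp only [h1, h2]
  have hrep : ∀ i : ℤ, ∃ (r : ℕ) (_ : r < m) (q : ℤ), i = (r : ℤ) + m * q := by
    intro i
    refine ⟨(i % m).toNat, hmod i, i / m, ?_⟩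
    have := Int.emod_nonneg i (by omega : (m : ℤ) ≠ 0)
    rw [Int.toNat_of_nonneg this, Int.emod_add_mul_ediv]
  refine ⟨m, e, ⟨by omega, strictMono_int_of_lt_succ ?_, ?_⟩, ?_⟩
  · intro i
    obtain ⟨r, hr, q, rfl⟩ := hrep i
    rw [he r hr]
    by_cases h : r + 1 < m
    · have h2 := he (r + 1) h q
      rw [show (r : ℤ) + m * q + 1 = ((r + 1 : ℕ) : ℤ) + m * q by push_cast; ring, h2]
      have : f ⟨r, hr⟩ < f ⟨r + 1, h⟩ := f.strictMono (by rw [Fin.lt_def]; simp)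
      linarith
    · have h2 := he 0 hmpos (q + 1)
      have hrm : (r : ℤ) + 1 = m := by omega
      rw [show (r : ℤ) + m * q + 1 = ((0 : ℕ) : ℤ) + m * (q + 1) by push_cast; linarith, h2]
      have := (hfm ⟨r, hr⟩).2
      have := (hfm ⟨0, hmpos⟩).1
      push_cast; linarith
  · intro i
    obtain ⟨r, hr, q, rfl⟩ := hrep i
    rw [he r hr, show (r : ℤ) + m * q + m = (r : ℤ) + m * (q + 1) by ring, he r hr]
    push_cast; ring
  · intro j
    have hx : toIcoMod hα 0 (θ j) ∈ E := Finset.mem_image_of_mem _ (Finset.mem_univ j)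
    have : toIcoMod hα 0 (θ j) ∈ Set.range f := by
      rw [hf, Finset.range_orderEmbOfFin]; exact hx
    obtain ⟨x, hx⟩ := this
    refine ⟨((x : ℕ) : ℤ) + m * toIcoDiv hα 0 (θ j), ?_⟩
    rw [he x x.isLt]
    have h1 := toIcoMod_add_toIcoDiv_zsmul hα 0 (θ j)
    rw [zsmul_eq_mul] at h1
    rw [← hx] at h1
    exact h1

/-- `c` colors the grid cells according to the arc coloring `(θ, k)`. -/
structure ArcRep {n : ℕ} [NeZero n] (M : ℤ) (e : ℤ → ℝ) (θ : Fin n → ℝ) (k : Fin n → Fin 3)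
    (c : ℤ → Fin 3) : Prop where
  pts : ∀ j, ∃ i, e i = θ j
  per : ∀ i q, c (i + 6 * M * q) = c i
  col : ∀ j i, θ j ≤ e i → e i < aE θ j → c i = k j

section rep
variable {n : ℕ} [NeZero n] {M : ℤ} {e : ℤ → ℝ} {θ : Fin n → ℝ} {k : Fin n → Fin 3} {c : ℤ → Fin 3}

lemma ArcRep.aE_pt (g : Grid M e) (r : ArcRep M e θ k c) (j : Fin n) :
    ∃ i, e i = aE θ j := by
  obtain ⟨i, hi⟩ := r.pts (j + 1)
  rcases aE_cases θ j with ⟨_, h2, h3⟩ | ⟨_, h2, h3⟩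
  · exact ⟨i, by rw [hi, h3]⟩
  · refine ⟨i + 6 * M * 1, ?_⟩
    rw [g.shift_six, hi, h3]; simp

lemma ArcRep.next (o : ArcOrd n θ) (g : Grid M e) (r : ArcRep M e θ k c) (j : Fin n) (p : ℤ)
    (hp : e p = aE θ j) : c p = k (j + 1) := by
  rcases aE_cases θ j with ⟨_, h2, h3⟩ | ⟨_, h2, h3⟩
  · exact r.col _ _ (by rw [hp, h3]) (by rw [hp, h3]; exact o.lt_aE _)
  · have hs := g.shift_six (-1) p
    rw [← r.per p (-1)]
    push_cast at hs
    have := o.lt_aE (j + 1)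
    exact r.col _ _ (by rw [hs, hp, h3]; linarith) (by rw [hs, hp, h3]; linarith)

lemma ArcRep.last (o : ArcOrd n θ) (g : Grid M e) (r : ArcRep M e θ k c) (j : Fin n) (p : ℤ)
    (hp : e p = aE θ j) : c (p - 1) = k j := by
  obtain ⟨i, hi⟩ := r.pts j
  have h1 : i < p := g.mono.lt_iff_lt.1 (by rw [hi, hp]; exact o.lt_aE j)
  apply r.col
  · rw [← hi]; exact g.mono.monotone (by omega)
  · rw [← hp]; exact g.mono (by omega)

lemma ArcRep.prev (o : ArcOrd n θ) (g : Grid M e) (r : ArcRep M e θ k c) (j : Fin n) (p : ℤ)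
    (hp : e p = θ j) : c (p - 1) = k (j - 1) := by
  have hj : j - 1 + 1 = j := sub_add_cancel j 1
  rcases aE_cases θ (j - 1) with ⟨_, h2, h3⟩ | ⟨_, h2, h3⟩
  · rw [hj] at h3
    exact r.last o g _ p (by rw [h3, hp])
  · rw [hj] at h3
    have hs := g.shift_six 1 p
    have := r.last o g (j - 1) (p + 6 * M * 1) (by rw [hs, h3, hp]; simp)
    rw [← this, ← r.per (p - 1) 1]; congr 1; ring

lemma ArcRep.here (o : ArcOrd n θ) (r : ArcRep M e θ k c) (j : Fin n) (p : ℤ)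
    (hp : e p = θ j) : c p = k j :=
  r.col j p hp.ge (by rw [hp]; exact o.lt_aE j)

lemma ArcRep.arc (g : Grid M e) (r : ArcRep M e θ k c) (j : Fin n) (p : ℤ) (s : ℝ)
    (h1 : θ j ≤ s) (h2 : s < aE θ j) (h3 : e p ≤ s) (h4 : s < e (p + 1)) : c p = k j := by
  obtain ⟨i, hi⟩ := r.pts j
  refine r.col j p ?_ (by linarith)
  have : i < p + 1 := g.mono.lt_iff_lt.1 (by rw [hi]; linarith)
  rw [← hi]; exact g.mono.monotone (by omega)

lemma ArcRep.proper (o : ArcOrd n θ) (g : Grid M e) (r : ArcRep M e θ k c) (hW : WP c M)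
    (hk : ∀ i, k (i + 1) ≠ k i) : IsProperArcColoring n (NeZero.ne n) θ k := by
  have hb : ∀ (i j : Fin n) (s t : ℝ) (q : ℤ), s ∈ Set.Ioo (θ i) (aE θ i) →
      t ∈ Set.Ioo (θ j) (aE θ j) → t = s + Real.pi / 3 + 2 * Real.pi * q → k i ≠ k j := by
    intro i j s t q hs ht hst
    obtain ⟨p, hp1, hp2⟩ := g.floor s
    rw [← r.arc g i p s hs.1.le hs.2 hp1 hp2]
    have e1 : e (p + M + 6 * M * q) = e p + Real.pi / 3 + 2 * Real.pi * q := by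
      rw [g.shift_six, g.shift]
    have e2 : e (p + M + 6 * M * q + 1) = e (p + 1) + Real.pi / 3 + 2 * Real.pi * q := by
      rw [show p + M + 6 * M * q + 1 = p + 1 + M + 6 * M * q by ring, g.shift_six, g.shift]
    rw [← r.arc g j (p + M + 6 * M * q) t ht.1.le ht.2 (by rw [e1]; linarith)
      (by rw [e2]; linarith), r.per]
    exact hW.1 p
  have hc : ∀ (i j : Fin n) (q : ℤ), θ j = θ i + Real.pi / 3 + 2 * Real.pi * q →
      ({k (i - 1), k i} : Set (Fin 3)) ≠ {k (j - 1), k j} := by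
    intro i j q hij
    obtain ⟨p, hp⟩ := r.pts i
    have e1 : e (p + M + 6 * M * q) = θ j := by
      rw [g.shift_six, g.shift, hp, hij]
    rw [← r.here o i p hp, ← r.prev o g i p hp, ← r.here o j _ e1, ← r.prev o g j _ e1,
      show p + M + 6 * M * q - 1 = p + M - 1 + 6 * M * q by ring, r.per, r.per]
    intro h
    rw [Set.pair_eq_pair_iff] at h
    rcases h with h | h
    · exact hW.1 p h.2
    · exact hW.2 p ⟨h.2, h.1⟩
  refine ⟨o.mono, o.last _, hk, ?_, ?_⟩
  · intro i j s t hs ht hst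
    obtain ⟨q, h | h⟩ := dist_one_cases hst
    · exact hb i j s t q hs ht h
    · exact (hb j i t s q ht hs h).symm
  · intro i j _ hij
    obtain ⟨q, h | h⟩ := dist_one_cases hij
    · exact hc i j q h
    · exact (hc j i q h).symm

lemma ArcRep.break_pt (o : ArcOrd n θ) (g : Grid M e) (r : ArcRep M e θ k c) (i : ℤ)
    (hi : c (i - 1) ≠ c i) : ∃ (j : Fin n) (q : ℤ), e (i + 6 * M * q) = θ j := by
  obtain ⟨j, q, h1, h2⟩ := o.cover (e i)
  have hs := g.shift_six (-q) i
  push_cast at hs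
  refine ⟨j, -q, ?_⟩
  by_contra hne
  obtain ⟨w, hw⟩ := r.pts j
  have h3 : e w < e (i + 6 * M * -q) :=
    lt_of_le_of_ne (by rw [hw, hs]; linarith) (by rw [hw]; exact Ne.symm hne)
  have h4 : w ≤ i + 6 * M * -q - 1 := by have := g.mono.lt_iff_lt.1 h3; omega
  have h5 : e (i + 6 * M * -q - 1) < e (i + 6 * M * -q) := g.mono (by omega)
  have c1 : c (i + 6 * M * -q) = k j := r.col j _ (by rw [hs]; linarith) (by rw [hs]; linarith)
  have c2 : c (i + 6 * M * -q - 1) = k j :=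
    r.col j _ (by rw [← hw]; exact g.mono.monotone h4) (by linarith)
  rw [show i + 6 * M * -q - 1 = i - 1 + 6 * M * -q by ring, r.per] at c2
  rw [r.per] at c1
  exact hi (by rw [c1, c2])

lemma ArcRep.wp (o : ArcOrd n θ) (g : Grid M e) (r : ArcRep M e θ k c)
    (hp : IsProperArcColoring n (NeZero.ne n) θ k) : WP c M := by
  obtain ⟨-, -, -, hb, hc⟩ := hp
  have hmid : ∀ i : ℤ, ∃ (j : Fin n) (q : ℤ), c i = k j ∧ θ j ≤ e i + 2 * Real.pi * q ∧
      e (i + 1) + 2 * Real.pi * q ≤ aE θ j := by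
    intro i
    obtain ⟨j, q, h1, h2⟩ := o.cover (e i)
    have hs := g.shift_six (-q) i
    have hs' := g.shift_six (-q) (i + 1)
    push_cast at hs hs'
    refine ⟨j, -q, ?_, by push_cast; linarith, ?_⟩
    · rw [← r.per i (-q)]
      exact r.col j _ (by rw [hs]; linarith) (by rw [hs]; linarith)
    · obtain ⟨w, hw⟩ := r.aE_pt g j
      have : i + 6 * M * -q < w := g.mono.lt_iff_lt.1 (by rw [hs, hw]; linarith)
      push_cast
      rw [← hs', ← hw]
      exact g.mono.monotone (by linarith)
  have hW1 : ∀ i, c i ≠ c (i + M) := by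
    intro i
    obtain ⟨j, q, h1, h2, h3⟩ := hmid i
    obtain ⟨j', q', h1', h2', h3'⟩ := hmid (i + M)
    have e1 := g.shift i
    have e2 := g.shift (i + 1)
    rw [show i + 1 + M = i + M + 1 by ring] at e2
    have hlt : e i < e (i + 1) := g.mono (by omega)
    rw [h1, h1']
    refine hb j j' ((e i + e (i + 1)) / 2 + 2 * Real.pi * q)
      ((e i + e (i + 1)) / 2 + Real.pi / 3 + 2 * Real.pi * q')
      ⟨by linarith, lt_of_lt_of_le (by linarith) h3⟩
      ⟨by linarith, lt_of_lt_of_le (by linarith) h3'⟩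
      (dist_one_of _ (q' - q) (by push_cast; ring))
  refine ⟨hW1, ?_⟩
  rintro i ⟨h1, h2⟩
  obtain ⟨j, q, hj⟩ := r.break_pt o g i (by rw [h2]; exact (hW1 i).symm)
  obtain ⟨j', q', hj'⟩ := r.break_pt o g (i + M) (by rw [← h1]; exact hW1 i)
  have hd : dist (circlePt (θ j)) (circlePt (θ j')) = 1 := by
    apply dist_one_of _ (q' - q)
    rw [← hj, ← hj', g.shift_six, g.shift_six, g.shift]; push_cast; ring
  have hne : j ≠ j' := by
    rintro rfl
    simp at hd
  apply hc j j' hne hd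
  have a1 := r.here o j _ hj
  have a2 := r.prev o g j _ hj
  have b1 := r.here o j' _ hj'
  have b2 := r.prev o g j' _ hj'
  rw [r.per] at a1 b1
  rw [show i + 6 * M * q - 1 = i - 1 + 6 * M * q by ring, r.per] at a2
  rw [show i + M + 6 * M * q' - 1 = i + M - 1 + 6 * M * q' by ring, r.per] at b2
  rw [← a1, ← a2, ← b1, ← b2, h1, h2]
  exact Set.pair_comm _ _

lemma exists_rep (o : ArcOrd n θ) (g : Grid M e) (hpt : ∀ j, ∃ i, e i = θ j) (k : Fin n → Fin 3) :
    ∃ c, ArcRep M e θ k c := by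
  choose J Q h1 h2 using fun i => o.cover (e i)
  refine ⟨fun i => k (J i), hpt, fun i q => ?_, fun j i h3 h4 => ?_⟩
  · have hs := g.shift_six q i
    have a1 := h1 (i + 6 * M * q)
    have a2 := h2 (i + 6 * M * q)
    have a3 := h1 i
    have a4 := h2 i
    rw [hs] at a1 a2
    refine congrArg k (o.uniq _ _ (Q (i + 6 * M * q) - q) (Q i) (e i) ?_ ?_ a3 a4)
    · push_cast; linarith
    · push_cast; linarith
  · refine congrArg k (o.uniq _ _ (Q i) 0 (e i) (h1 i) (h2 i) ?_ ?_)
    · simpa using h3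
    · simpa using h4

end rep

/-- Any proper finite arc coloring of the unit circle can be turned into a proper cyclic one
by keeping a subset of the breakpoints (so no new bichromatic points appear) and recoloring
the arcs. -/
theorem stmt_13 (n : ℕ) (hn : n ≠ 0) (θ : Fin n → ℝ) (k : Fin n → Fin 3)
    (hp : IsProperArcColoring n hn θ k) :
    ∃ (m : ℕ) (hm3 : 3 ≤ m) (_ : m ≤ n) (σ : Fin m → Fin n) (k' : Fin m → Fin 3),
      StrictMono σ ∧
      IsProperArcColoring m (by omega) (θ ∘ σ) k' ∧
      IsCyclicArcColoring m (by omega) k' := by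
  classical
  haveI : NeZero n := ⟨hn⟩
  have o : ArcOrd n θ := by
    refine ⟨hp.1, fun j => lt_of_le_of_lt (hp.1.monotone ?_) hp.2.1⟩
    rw [Fin.le_def]
    have := j.isLt
    show (j : ℕ) ≤ n - 1
    omega
  obtain ⟨M, e, g, hpt⟩ := exists_grid θ
  obtain ⟨c, r⟩ := exists_rep o g hpt k
  have hW := r.wp o g hp
  obtain ⟨c', hW', hper', hD, hR⟩ := comb_main g.pos _ c hW
    (fun i => by simpa using r.per i 1) rfl
  have hper : ∀ i q, c' (i + 6 * M * q) = c' i := by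
    intro i q
    have hf : Function.Periodic c' (6 * M) := hper'
    have := hf.int_mul q i
    rw [← this]; simp only [Int.cast_id]; congr 1; ring
  choose P hP using hpt
  -- every break of `c'` is one of the breakpoints
  have hbr : ∀ i, c' (i - 1) ≠ c' i → ∃ (j : Fin n) (q : ℤ), e i = θ j + 2 * Real.pi * q ∧
      c' (P j - 1) ≠ c' (P j) := by
    intro i hi
    obtain ⟨j, q, hj⟩ := r.break_pt o g i (hD i hi)
    have hPj : P j = i + 6 * M * q := g.mono.injective (by rw [hP, hj])
    refine ⟨j, -q, ?_, ?_⟩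
    · rw [← hj, g.shift_six]; push_cast; ring
    · rw [hPj, show i + 6 * M * q - 1 = i - 1 + 6 * M * q by ring, hper, hper]; exact hi
  set T : Finset (Fin n) := Finset.univ.filter fun j => c' (P j - 1) ≠ c' (P j) with hT
  have hTmem : ∀ j, j ∈ T ↔ c' (P j - 1) ≠ c' (P j) := by intro j; simp [hT]
  obtain ⟨m, hm⟩ : ∃ m, T.card = m := ⟨_, rfl⟩
  have hconst : ∀ (i : ℤ) (l : ℕ), (∀ w, i < w → w ≤ i + l → c' (w - 1) = c' w) →
      c' (i + l) = c' i := by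
    intro i l
    induction l with
    | zero => intro _; simp
    | succ l ih =>
      intro h
      rw [← ih fun w h1 h2 => h w h1 (by push_cast; omega),
        ← h (i + (l + 1 : ℕ)) (by push_cast; omega) le_rfl]
      congr 1; push_cast; ring
  have hTne : T.Nonempty := by
    by_contra hcon
    have : c' (0 + (M.toNat : ℤ)) = c' 0 := hconst 0 _ fun w _ _ => by
      by_contra hw
      obtain ⟨j, _, _, hj⟩ := hbr w hw
      exact hcon ⟨j, (hTmem j).2 hj⟩
    rw [Int.toNat_of_nonneg g.pos.le] at this
    exact hW'.1 0 this.symm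
  have hm0 : m ≠ 0 := by rw [← hm]; exact hTne.card_pos.ne'
  haveI : NeZero m := ⟨hm0⟩
  set σ := T.orderEmbOfFin hm with hσ
  have hσT : ∀ x, σ x ∈ T := fun x => Finset.orderEmbOfFin_mem T hm x
  have o' : ArcOrd m (θ ∘ σ) := by
    refine ⟨o.mono.comp σ.strictMono, fun j => ?_⟩
    have h1 := o.last (σ j)
    have h2 := o.zero_le (σ 0)
    simp only [Function.comp]
    linarith
  have r' : ArcRep M e (θ ∘ σ) (fun x => c' (P (σ x))) c' := by
    refine ⟨fun j => ⟨P (σ j), hP _⟩, hper, fun x i h1 h2 => ?_⟩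
    have h1' : e (P (σ x)) ≤ e i := by rw [hP]; exact h1
    have hle : P (σ x) ≤ i := g.mono.le_iff_le.1 h1'
    have := hconst (P (σ x)) (i - P (σ x)).toNat fun w hw1 hw2 => by
      by_contra hw
      obtain ⟨j, q, hj1, hj2⟩ := hbr w hw
      have : j ∈ Set.range σ := by
        rw [hσ, Finset.range_orderEmbOfFin]; exact (hTmem j).2 hj2
      obtain ⟨y, rfl⟩ := this
      have l1 : e (P (σ x)) < e w := g.mono hw1
      have l2 : e w ≤ e i := g.mono.monotone (by omega)
      rw [hP] at l1
      exact o'.no_break x y q (by simpa using hj1 ▸ l1)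
        (lt_of_le_of_lt (by simpa using hj1 ▸ l2) h2)
    rw [← this]; congr 1; omega
  have hk' : ∀ x : Fin m, c' (P (σ (x + 1))) ≠ c' (P (σ x)) := by
    intro x
    have h1 := r'.prev o' g (x + 1) (P (σ (x + 1))) (hP _)
    have h2 := (hTmem _).1 (hσT (x + 1))
    rw [add_sub_cancel_right] at h1
    rw [h1] at h2
    exact h2.symm
  have hcyc : ∀ x : Fin m, c' (P (σ (x + 1))) ≠ c' (P (σ (x - 1))) := by
    intro x hx
    obtain ⟨q, hq⟩ := r'.aE_pt g x
    have h1 := r'.prev o' g x (P (σ x)) (hP _)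
    have h2 := r'.next o' g x q hq
    have hlt : P (σ x) < q := g.mono.lt_iff_lt.1 (by rw [hP, hq]; exact o'.lt_aE x)
    refine hR (P (σ x)) q ⟨hlt, (hTmem _).1 (hσT x), fun w hw1 hw2 => ?_, ?_⟩
    · refine r'.col x w ?_ ?_
      · have := g.mono.monotone hw1
        rwa [hP] at this
      · rw [← hq]; exact g.mono hw2
    · rw [h1, h2]; exact hx
  have hm3 : 3 ≤ m := by
    by_contra hcon
    have : m = 1 ∨ m = 2 := by omega
    rcases this with h | h
    · subst h
      exact hk' 0 (by congr 1)
    · subst h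
      exact hcyc 0 (by congr 1)
  refine ⟨m, hm3, ?_, σ, fun x => c' (P (σ x)), σ.strictMono, r'.proper o' g hW' hk', hcyc⟩
  rw [← hm]
  simpa using Finset.card_le_univ T
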